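/- arXiv:2205.14823 — 2 statements merged into one kernel-verified Lean document; each statement's English description precedes it below -/
import Mathlib

section
/- Let p, q be natural numbers and let h : ℝ^p × ℝ^q → ℝ be a C² function with h(x,y) > 0 for all (x,y), such that the function (x,y) ↦ log(h(x,y)) has vanishing mixed second derivatives, i.e. for every point (x,y) and all vectors u ∈ ℝ^p, v ∈ ℝ^q, the second Fréchet derivative of log ∘ h at (x,y) applied to ((u,0),(0,v)) is zero. Then there exist functions Φ : ℝ^p → ℝ and Ψ : ℝ^q → ℝ with Φ(x) > 0 and Ψ(y) > 0 for all x, y, such that h(x,y) = Φ(x) · Ψ(y) for all (x,y). (This is the factorization h = Φ(s)Ψ(t) of the twisting function established in the proof of Theorem 4.2, which allows the super twisted product metric g₁ ⊕ h² g₂ to be rewritten as the super warped product metric g₁ ⊕ Φ² ĝ₂ with ĝ₂ = Ψ² g₂.) -/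
/-- A `C²` function on a product whose mixed second derivatives vanish is a sum of a function of the
first variable and a function of the second. -/
theorem ContDiff.add_eq_add_of_mixed_fderiv_eq_zero {E F G : Type*}
    [NormedAddCommGroup E] [NormedSpace ℝ E] [NormedAddCommGroup F] [NormedSpace ℝ F]
    [NormedAddCommGroup G] [NormedSpace ℝ G] {f : E × F → G} (hf : ContDiff ℝ 2 f)
    (hmixed : ∀ x y u v, fderiv ℝ (fderiv ℝ f) (x, y) (u, 0) (0, v) = 0) (x x₀ : E) (y y₀ : F) :
    f (x, y) + f (x₀, y₀) = f (x, y₀) + f (x₀, y) := by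
  have hd : Differentiable ℝ f := hf.differentiable (by norm_num)
  have hd' : Differentiable ℝ (fderiv ℝ f) :=
    (hf.fderiv_right (m := 1) (by norm_num)).differentiable (by norm_num)
  have partial_const (v : F) (b : F) (a a' : E) :
      fderiv ℝ f (a, b) (0, v) = fderiv ℝ f (a', b) (0, v) := by
    have hderiv (a : E) : HasFDerivAt (fun a => fderiv ℝ f (a, b) (0, v)) (0 : E →L[ℝ] G) a := by
      have hcomp : HasFDerivAt (fun a => fderiv ℝ f (a, b))
          ((fderiv ℝ (fderiv ℝ f) (a, b)).comp (ContinuousLinearMap.inl ℝ E F)) a :=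
        (hd' (a, b)).hasFDerivAt.comp a (hasFDerivAt_prodMk_left a b)
      have h := hcomp.clm_apply (hasFDerivAt_const ((0, v) : E × F) a)
      refine h.congr_fderiv ?_
      ext u
      simp [hmixed]
    exact is_const_of_fderiv_eq_zero (fun a => (hderiv a).differentiableAt)
      (fun a => (hderiv a).fderiv) a a'
  have hderiv (b : F) : HasFDerivAt (fun b => f (x, b) - f (x₀, b)) (0 : F →L[ℝ] G) b := by
    have h := ((hd (x, b)).hasFDerivAt.comp b (hasFDerivAt_prodMk_right x b)).sub
      ((hd (x₀, b)).hasFDerivAt.comp b (hasFDerivAt_prodMk_right x₀ b))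
    refine h.congr_fderiv ?_
    ext v
    simp [partial_const v b x x₀]
  have h := is_const_of_fderiv_eq_zero (fun b => (hderiv b).differentiableAt)
    (fun b => (hderiv b).fderiv) y y₀
  rw [sub_eq_sub_iff_add_eq_add] at h
  exact h

theorem twisting_function_factorization_of_vanishing_mixed_log_derivatives
    (p q : ℕ) (h : (EuclideanSpace ℝ (Fin p)) × (EuclideanSpace ℝ (Fin q)) → ℝ)
    (hC2 : ContDiff ℝ 2 h)
    (hpos : ∀ (x : EuclideanSpace ℝ (Fin p)) (y : EuclideanSpace ℝ (Fin q)), 0 < h (x, y))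
    (hmixed : ∀ (x : EuclideanSpace ℝ (Fin p)) (y : EuclideanSpace ℝ (Fin q))
      (u : EuclideanSpace ℝ (Fin p)) (v : EuclideanSpace ℝ (Fin q)),
      fderiv ℝ (fderiv ℝ (fun z => Real.log (h z))) (x, y) (u, 0) (0, v) = 0) :
    ∃ (Φ : EuclideanSpace ℝ (Fin p) → ℝ) (Ψ : EuclideanSpace ℝ (Fin q) → ℝ),
      (∀ x, 0 < Φ x) ∧ (∀ y, 0 < Ψ y) ∧
      ∀ (x : EuclideanSpace ℝ (Fin p)) (y : EuclideanSpace ℝ (Fin q)),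
        h (x, y) = Φ x * Ψ y := by
  have hlog : ContDiff ℝ 2 (fun z => Real.log (h z)) :=
    hC2.log fun z => (hpos z.1 z.2).ne'
  refine ⟨fun x => h (x, 0), fun y => h (0, y) / h (0, 0), fun x => hpos x 0,
    fun y => div_pos (hpos 0 y) (hpos 0 0), fun x y => ?_⟩
  have key := hlog.add_eq_add_of_mixed_fderiv_eq_zero hmixed x 0 y 0
  rw [← Real.log_mul (hpos _ _).ne' (hpos _ _).ne',
    ← Real.log_mul (hpos _ _).ne' (hpos _ _).ne'] at key
  have := Real.log_injOn_pos (mul_pos (hpos _ _) (hpos _ _)) (mul_pos (hpos _ _) (hpos _ _)) key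
  rw [← mul_div_assoc, eq_div_iff (hpos 0 0).ne', this]
end

section
/- Let p, q be natural numbers and let h : ℝ^p × ℝ^q → ℝ be a smooth (C^∞) function with h(x,y) > 0 for all (x,y). Then the function (x,y) ↦ log(h(x,y)) has vanishing mixed second derivatives (for every point (x,y) and all vectors u ∈ ℝ^p, v ∈ ℝ^q, the second Fréchet derivative of log ∘ h at (x,y) applied to ((u,0),(0,v)) is zero) if and only if there exist smooth functions Φ : ℝ^p → ℝ and Ψ : ℝ^q → ℝ, positive everywhere, such that h(x,y) = Φ(x) · Ψ(y) for all (x,y). (This equivalence is the analytic content of Theorem 4.2 and Corollary 4.4: a super twisted product with twisting function h is mixed Ricci-flat, equivalently satisfies K(X,Y)Q = 0 for base vector fields X, Y and fiber vector field Q, precisely when it can be expressed as a super warped product.) -/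
section MixedDerivative

variable {E F G : Type*} [NormedAddCommGroup E] [NormedSpace ℝ E] [NormedAddCommGroup F]
  [NormedSpace ℝ F] [NormedAddCommGroup G] [NormedSpace ℝ G]

/-- The derivative of a function on a product along the second factor is a partial derivative. -/
theorem fderiv_apply_zero_right_eq {f : E × F → G} (hf : Differentiable ℝ f)
    (x : E) (y v : F) :
    fderiv ℝ f (x, y) (0, v) = fderiv ℝ (fun y' => f (x, y')) y v := by
  have hd := (hf (x, y)).hasFDerivAt.comp y (hasFDerivAt_prodMk_right x y)
  have hd' : HasFDerivAt (fun y' => f (x, y')) _ y := hd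
  simp [hd'.fderiv]

/-- The mixed second derivative of a function on a product is an iterated partial derivative. -/
theorem fderiv_fderiv_mixed_eq {f : E × F → G} (hf : ContDiff ℝ 2 f) (x u : E) (y v : F) :
    fderiv ℝ (fderiv ℝ f) (x, y) (u, 0) (0, v) =
      fderiv ℝ (fun x' => fderiv ℝ (fun y' => f (x', y')) y v) x u := by
  have hdiff : Differentiable ℝ (fderiv ℝ f) :=
    (hf.fderiv_right (m := 1) (by norm_num)).differentiable one_ne_zero
  have hd := (hdiff (x, y)).hasFDerivAt.comp x (hasFDerivAt_prodMk_left (𝕜 := ℝ) x y)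
  have hd' : HasFDerivAt (fun x' => fderiv ℝ f (x', y) (0, v)) _ x :=
    hd.clm_apply (hasFDerivAt_const (0, v) x)
  simp_rw [← fderiv_apply_zero_right_eq (hf.differentiable two_ne_zero)]
  simp [hd'.fderiv]

/-- The mixed second derivatives of a `C^2` function on a product vanish if and only if the
function is a sum of functions of each variable, expressed through its restrictions to the axes. -/
theorem fderiv_fderiv_mixed_eq_zero_iff {f : E × F → G} (hf : ContDiff ℝ 2 f) :
    (∀ x y u v, fderiv ℝ (fderiv ℝ f) (x, y) (u, 0) (0, v) = 0) ↔
      ∀ x y, f (x, y) = f (x, 0) + (f (0, y) - f (0, 0)) := by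
  have hf1 : Differentiable ℝ f := hf.differentiable two_ne_zero
  have hslice (x : E) : Differentiable ℝ (fun y => f (x, y)) := by fun_prop
  constructor
  · intro H x y
    have hconst (y v : F) : fderiv ℝ f (x, y) (0, v) = fderiv ℝ f (0, y) (0, v) := by
      have hdiff : Differentiable ℝ (fderiv ℝ f) :=
        (hf.fderiv_right (m := 1) (by norm_num)).differentiable one_ne_zero
      refine is_const_of_fderiv_eq_zero (𝕜 := ℝ)
        (f := fun x' => fderiv ℝ f (x', y) (0, v)) (by fun_prop) (fun x' => ?_) x 0
      ext u
      simp_rw [fderiv_apply_zero_right_eq hf1]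
      rw [← fderiv_fderiv_mixed_eq hf, H]
      rfl
    have hsub := is_const_of_fderiv_eq_zero (𝕜 := ℝ) (f := fun y' => f (x, y') - f (0, y'))
      ((hslice x).sub (hslice 0)) (fun y' => by
        ext v
        rw [fderiv_fun_sub (hslice x y') (hslice 0 y')]
        simp [← fderiv_apply_zero_right_eq hf1, hconst]) y 0
    rw [sub_eq_iff_eq_add.mp hsub]
    abel
  · intro H x y u v
    rw [fderiv_fderiv_mixed_eq hf]
    have hslice_eq (x' : E) :
        fderiv ℝ (fun y' => f (x', y')) y v = fderiv ℝ (fun y' => f (0, y') - f (0, 0)) y v := by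
      rw [show (fun y' => f (x', y')) = fun y' => f (x', 0) + (f (0, y') - f (0, 0)) from
        funext (H x'), fderiv_const_add]
    simp [hslice_eq]

end MixedDerivative

theorem vanishing_mixed_log_derivatives_iff_warped_product_form
    (p q : ℕ) (h : (EuclideanSpace ℝ (Fin p)) × (EuclideanSpace ℝ (Fin q)) → ℝ)
    (hsmooth : ContDiff ℝ (⊤ : ℕ∞) h)
    (hpos : ∀ (x : EuclideanSpace ℝ (Fin p)) (y : EuclideanSpace ℝ (Fin q)), 0 < h (x, y)) :
    (∀ (x : EuclideanSpace ℝ (Fin p)) (y : EuclideanSpace ℝ (Fin q))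
      (u : EuclideanSpace ℝ (Fin p)) (v : EuclideanSpace ℝ (Fin q)),
      fderiv ℝ (fderiv ℝ (fun z => Real.log (h z))) (x, y) (u, 0) (0, v) = 0) ↔
    (∃ (Φ : EuclideanSpace ℝ (Fin p) → ℝ) (Ψ : EuclideanSpace ℝ (Fin q) → ℝ),
      ContDiff ℝ (⊤ : ℕ∞) Φ ∧ ContDiff ℝ (⊤ : ℕ∞) Ψ ∧ (∀ x, 0 < Φ x) ∧ (∀ y, 0 < Ψ y) ∧
      ∀ (x : EuclideanSpace ℝ (Fin p)) (y : EuclideanSpace ℝ (Fin q)),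
        h (x, y) = Φ x * Ψ y) := by
  have hpos' (z : EuclideanSpace ℝ (Fin p) × EuclideanSpace ℝ (Fin q)) : 0 < h z := hpos z.1 z.2
  have hlog : ContDiff ℝ 2 (fun z => Real.log (h z)) :=
    (contDiff_infty.mp hsmooth 2).log fun z => (hpos' z).ne'
  rw [fderiv_fderiv_mixed_eq_zero_iff hlog]
  constructor
  · intro H
    refine ⟨fun x => h (x, 0), fun y => h (0, y) / h (0, 0), by fun_prop, by fun_prop,
      fun x => hpos' _, fun y => div_pos (hpos' _) (hpos' _), fun x y => ?_⟩
    have hxy := H x y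
    rw [← Real.log_div (hpos' _).ne' (hpos' _).ne',
      ← Real.log_mul (hpos' _).ne' (div_pos (hpos' _) (hpos' _)).ne'] at hxy
    exact Real.log_injOn_pos (hpos' _) (mul_pos (hpos' _) (div_pos (hpos' _) (hpos' _))) hxy
  · rintro ⟨Φ, Ψ, -, -, hΦ, hΨ, hfac⟩ x y
    simp only [hfac, Real.log_mul (hΦ _).ne' (hΨ _).ne']
    ring
end
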